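/- Let X be a path connected topological space and let x, y ∈ X. Then the Snake cones SC(X,x) and SC(X,y) are homotopy equivalent topological spaces. -/

import Mathlib

open Set Filter unitInterval

noncomputable section

/-! ## The piecewise linear topologist sine curve `𝒯` and the Snake cone `SC(X,x)` -/

/-- The unit square `𝕀² ⊆ ℝ²`. -/
def unitSq : Set (ℝ × ℝ) := Icc (0 : ℝ) 1 ×ˢ Icc (0 : ℝ) 1

/-- The piecewise linear topologist sine curve `𝒯 ⊆ 𝕀²`: the union of the limit segment
`L = [A,B] = {0} × [0,1]`, the vertical segments `L_{2n-1} = [Aₙ,Bₙ]` and the slanted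
segments `L_{2n} = [Bₙ,A_{n+1}]`, where `Aₙ = (1/n,0)`, `Bₙ = (1/n,1)`. -/
def Tcurve : Set (ℝ × ℝ) :=
  ({0} ×ˢ Icc (0 : ℝ) 1) ∪
  (⋃ n : ℕ, segment ℝ (1 / (n + 1), 0) (1 / (n + 1), 1)) ∪
  (⋃ n : ℕ, segment ℝ (1 / (n + 1), 1) (1 / (n + 2), 0))

variable (X : Type*) [TopologicalSpace X] (x : X)

/-- The identification relation defining `SC(X,x)` on `(𝒯 × X) ⊔ 𝕀²`: for `t ∈ 𝒯 ∖ L`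
(i.e. `t.1 ≠ 0`) the point `(t,x)` is identified with `t ∈ 𝕀²`, and for `t ∈ L`
(i.e. `t.1 = 0`) every point `(t,u)` is identified with the point `t ∈ 𝕀²`
(so `{t} × X` is collapsed to `t`). -/
def scRel : (↥Tcurve × X) ⊕ ↥unitSq → (↥Tcurve × X) ⊕ ↥unitSq → Prop := fun a b =>
  (∃ (t : ↥Tcurve) (w : ↥unitSq), (t : ℝ × ℝ).1 ≠ 0 ∧ (t : ℝ × ℝ) = (w : ℝ × ℝ) ∧
      a = Sum.inl (t, x) ∧ b = Sum.inr w) ∨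
  (∃ (t : ↥Tcurve) (u : X) (w : ↥unitSq), (t : ℝ × ℝ).1 = 0 ∧ (t : ℝ × ℝ) = (w : ℝ × ℝ) ∧
      a = Sum.inl (t, u) ∧ b = Sum.inr w)

/-- The Snake cone `SC(X,x)`, with the quotient topology. -/
def SC := Quot (scRel X x)

instance : TopologicalSpace (SC X x) :=
  inferInstanceAs (TopologicalSpace (Quot (scRel X x)))

end


namespace SnakeCone

open Topology

/-! ### The retraction of the wedge over the square -/

/-- width of the `n`-th strip `[1/(n+2), 1/(n+1)]` -/
noncomputable def wid (n : ℕ) : ℝ := 1 / (n + 1) - 1 / (n + 2)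

lemma wid_pos (n : ℕ) : 0 < wid n := by
  unfold wid
  have : (0:ℝ) < n + 1 := by positivity
  rw [sub_pos]
  exact one_div_lt_one_div_of_lt this (by linarith)

lemma wid_le (n : ℕ) : wid n ≤ 1 := by
  unfold wid
  have h0 : (0:ℝ) ≤ n := by positivity
  have : (1:ℝ) / (n + 1) ≤ 1 := by
    rw [div_le_one (by positivity)]; linarith
  have : (0:ℝ) ≤ 1 / (n + 2) := by positivity
  linarith

/-- clamped normalized coordinate in the `n`-th strip -/
noncomputable def al (n : ℕ) (a : ℝ) : ℝ := max 0 (min 1 ((a - 1 / (n + 2)) / wid n))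

/-- signed hitting time -/
noncomputable def sg (α y : ℝ) : ℝ := 2 * max (-α) (min (1 - α) (α - y))

noncomputable def cl (s r : ℝ) : ℝ := max (-s) (min s r)

/-- signed displacement for the `n`-th strip -/
noncomputable def rh (n : ℕ) (z : (ℝ × ℝ) × ℝ) : ℝ := cl z.2 (sg (al n z.1.1) z.1.2)

def K : Set ((ℝ × ℝ) × ℝ) := {z | z.1 ∈ unitSq ∧ 0 ≤ z.2 ∧ z.2 ≤ z.1.1}

lemma rh_cont (n : ℕ) : Continuous (rh n) := by
  unfold rh cl sg al
  fun_prop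

lemma cl_abs {s r : ℝ} (hs : 0 ≤ s) : |cl s r| ≤ s := by
  unfold cl
  rw [abs_le]
  refine ⟨le_max_left _ _, max_le (by linarith) (min_le_left _ _)⟩

lemma cl_zero {s : ℝ} (hs : 0 ≤ s) : cl s 0 = 0 := by
  unfold cl
  simp [hs]

lemma sg_zero {y : ℝ} (hy : 0 ≤ y) : sg 0 y = 0 := by
  unfold sg
  simp [hy]

lemma sg_one {y : ℝ} (hy : y ≤ 1) : sg 1 y = 0 := by
  unfold sg
  simp [hy]

lemma sg_diag {y : ℝ} (hy : 0 ≤ y) (hy : y ≤ 1) : sg y y = 0 := by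
  unfold sg
  simp [*]

lemma al_left {n : ℕ} {a : ℝ} (h : a ≤ 1 / (n + 2)) : al n a = 0 := by
  unfold al
  have : (a - 1 / (n + 2)) / wid n ≤ 0 := div_nonpos_of_nonpos_of_nonneg (by linarith) (wid_pos n).le
  rw [max_eq_left]
  exact (min_le_right _ _).trans this

lemma al_right {n : ℕ} {a : ℝ} (h : 1 / (n + 1) ≤ a) : al n a = 1 := by
  unfold al
  have : 1 ≤ (a - 1 / (n + 2)) / wid n := by
    rw [le_div_iff₀ (wid_pos n)]; unfold wid; linarith
  rw [min_eq_left this]; simp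

lemma al_mid {n : ℕ} {α : ℝ} (h0 : 0 ≤ α) (h1 : α ≤ 1) : al n (1 / (n + 2) + α * wid n) = α := by
  unfold al
  have : (1 / ((n:ℝ) + 2) + α * wid n - 1 / (n + 2)) / wid n = α := by
    have := (wid_pos n).ne'
    field_simp
    ring
  rw [this, min_eq_right h1, max_eq_right h0]

/-- every positive `a ≤ 1` lies in some strip -/
lemma exists_strip {a : ℝ} (h0 : 0 < a) (h1 : a ≤ 1) :
    ∃ (m : ℕ) (α : ℝ), 0 ≤ α ∧ α ≤ 1 ∧ a = 1 / (m + 2) + α * wid m := by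
  have hone : (1:ℝ) ≤ 1 / a := by rw [le_div_iff₀ h0]; linarith
  have hf : 1 ≤ ⌊1 / a⌋₊ := by
    rw [Nat.one_le_floor_iff]; exact hone
  obtain ⟨m, hm⟩ := Nat.exists_eq_add_of_le hf
  have e1 : ((m:ℝ) + 1) ≤ 1 / a := by
    have := Nat.floor_le (show 0 ≤ 1 / a by positivity)
    rw [hm] at this; push_cast at this; linarith
  have e2 : 1 / a < (m:ℝ) + 2 := by
    have := Nat.lt_floor_add_one (1 / a)
    rw [hm] at this; push_cast at this; linarith
  have f1 : a ≤ 1 / ((m:ℝ) + 1) := by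
    rw [le_div_iff₀ (by positivity)]
    rw [le_div_iff₀ h0] at e1; linarith
  have f2 : 1 / ((m:ℝ) + 2) ≤ a := by
    rw [div_le_iff₀ (by positivity)]
    rw [div_lt_iff₀ h0] at e2; linarith
  refine ⟨m, (a - 1 / (m + 2)) / wid m, div_nonneg (by linarith) (wid_pos m).le, ?_, ?_⟩
  · rw [div_le_one (wid_pos m)]; unfold wid; linarith
  · rw [div_mul_cancel₀ _ (wid_pos m).ne']; ring

lemma strip_le {m : ℕ} {α : ℝ} (h0 : 0 ≤ α) (h1 : α ≤ 1) :
    1 / ((m:ℝ) + 2) ≤ 1 / (m + 2) + α * wid m ∧ 1 / ((m:ℝ) + 2) + α * wid m ≤ 1 / (m + 1) := by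
  have := wid_pos m
  constructor
  · nlinarith
  · have : α * wid m ≤ 1 * wid m := by gcongr
    unfold wid at *; linarith

lemma rh_strip {m n : ℕ} (hn : n ≠ m) {z : (ℝ × ℝ) × ℝ} (hz : z ∈ K) {α : ℝ} (h0 : 0 ≤ α)
    (h1 : α ≤ 1) (ha : z.1.1 = 1 / (m + 2) + α * wid m) : rh n z = 0 := by
  obtain ⟨⟨hx, hy⟩, hs, hsa⟩ := hz
  obtain ⟨l1, l2⟩ := strip_le (m := m) h0 h1
  unfold rh
  rcases lt_or_gt_of_ne hn with h | h
  · have : (n:ℝ) + 1 ≤ m := by exact_mod_cast h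
    rw [al_left, sg_zero hy.1, cl_zero hs]
    rw [ha]
    refine l2.trans ?_
    exact one_div_le_one_div_of_le (by positivity) (by linarith)
  · have : (m:ℝ) + 1 ≤ n := by exact_mod_cast h
    rw [al_right, sg_one hy.2, cl_zero hs]
    rw [ha]
    refine le_trans ?_ l1
    exact one_div_le_one_div_of_le (by positivity) (by linarith)

lemma rh_abs {n : ℕ} {z : (ℝ × ℝ) × ℝ} (hz : z ∈ K) : |rh n z| ≤ z.2 := cl_abs hz.2.1

noncomputable def rs (c : ℕ → ℝ) (z : (ℝ × ℝ) × ℝ) : ℝ := ∑' n, c n * rh n z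

lemma rs_zero (c : ℕ → ℝ) {z : (ℝ × ℝ) × ℝ} (h : ∀ n, rh n z = 0) : rs c z = 0 := by
  unfold rs
  simp [h]

lemma rh_of_snd {z : (ℝ × ℝ) × ℝ} (hz : z ∈ K) (h : z.2 = 0) (n : ℕ) : rh n z = 0 := by
  have := rh_abs (n := n) hz
  rw [h] at this
  simpa using this

lemma snd_of_fst {z : (ℝ × ℝ) × ℝ} (hz : z ∈ K) (h : z.1.1 = 0) : z.2 = 0 := by
  have := hz.2.1
  have := hz.2.2
  linarith

lemma rs_strip (c : ℕ → ℝ) {m : ℕ} {z : (ℝ × ℝ) × ℝ} (hz : z ∈ K) {α : ℝ} (h0 : 0 ≤ α)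
    (h1 : α ≤ 1) (ha : z.1.1 = 1 / (m + 2) + α * wid m) : rs c z = c m * rh m z := by
  unfold rs
  refine tsum_eq_single m fun n hn => ?_
  rw [rh_strip hn hz h0 h1 ha, mul_zero]

lemma rs_cont (c : ℕ → ℝ) (hc : ∀ n, |c n| ≤ 1) : Continuous (fun z : K => rs c z) := by
  have key : TendstoUniformly (fun (N : ℕ) (z : K) => ∑ n ∈ Finset.range N, c n * rh n z)
      (fun z : K => rs c z) atTop := by
    rw [Metric.tendstoUniformly_iff]
    intro ε hε
    obtain ⟨N₀, hN₀⟩ := exists_nat_one_div_lt hε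
    filter_upwards [eventually_ge_atTop N₀] with N hN z
    obtain ⟨z, hz⟩ := z
    show dist (rs c z) (∑ n ∈ Finset.range N, c n * rh n z) < ε
    have triv : (∀ n, rh n z = 0) → dist (rs c z) (∑ n ∈ Finset.range N, c n * rh n z) < ε := by
      intro h
      rw [rs_zero c h]
      simp [h, hε]
    rcases eq_or_lt_of_le hz.1.1.1 with h | h
    · exact triv (rh_of_snd hz (snd_of_fst hz h.symm))
    · obtain ⟨m, α, h0, h1, ha⟩ := exists_strip h hz.1.1.2
      rw [rs_strip c hz h0 h1 ha]
      by_cases hm : m < N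
      · rw [Finset.sum_eq_single m]
        · simpa using hε
        · intro n _ hn
          rw [rh_strip hn hz h0 h1 ha, mul_zero]
        · intro h
          exact absurd (Finset.mem_range.2 hm) h
      · rw [Finset.sum_eq_zero]
        · rw [Real.dist_eq, sub_zero, abs_mul]
          have e1 : |rh m z| ≤ z.2 := rh_abs hz
          have e2 := hz.2.2
          have e3 := (strip_le (m := m) h0 h1).2
          rw [← ha] at e3
          have e4 : (1:ℝ) / (m + 1) ≤ 1 / (N₀ + 1) := by
            apply one_div_le_one_div_of_le (by positivity)
            have : N₀ ≤ m := by omega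
            have : (N₀:ℝ) ≤ m := by exact_mod_cast this
            linarith
          have : |c m| * |rh m z| ≤ 1 * |rh m z| := by gcongr; exact hc m
          linarith
        · intro n hn
          rw [rh_strip _ hz h0 h1 ha, mul_zero]
          rw [Finset.mem_range] at hn
          omega
  refine key.continuous (Frequently.of_forall fun N => ?_)
  have := rh_cont
  fun_prop

lemma sg_cases {α y : ℝ} (h0 : 0 ≤ α) (h1 : α ≤ 1) (hy0 : 0 ≤ y) (hy1 : y ≤ 1) :
    (y ≤ α ∧ 0 ≤ sg α y ∧ sg α y ≤ 2 * (1 - α) ∧ sg α y ≤ 2 * (α - y) ∧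
      (sg α y = 2 * (1 - α) ∨ sg α y = 2 * (α - y))) ∨
    (α ≤ y ∧ sg α y ≤ 0 ∧ -(2 * α) ≤ sg α y ∧ -(2 * (y - α)) ≤ sg α y ∧
      (sg α y = -(2 * α) ∨ sg α y = 2 * (α - y))) := by
  unfold sg
  rcases le_total y α with h | h
  · left
    have e : max (-α) (min (1 - α) (α - y)) = min (1 - α) (α - y) :=
      max_eq_right (le_min (by linarith) (by linarith))
    rw [e]
    have e1 := min_le_left (1 - α) (α - y)
    have e2 := min_le_right (1 - α) (α - y)
    have e3 : 0 ≤ min (1 - α) (α - y) := le_min (by linarith) (by linarith)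
    refine ⟨h, by linarith, by linarith, by linarith, ?_⟩
    rcases min_choice (1 - α) (α - y) with e | e <;> rw [e] <;> simp
  · right
    have e : min (1 - α) (α - y) = α - y := min_eq_right (by linarith)
    rw [e]
    have e1 := le_max_left (-α) (α - y)
    have e2 := le_max_right (-α) (α - y)
    have e3 : max (-α) (α - y) ≤ 0 := max_le (by linarith) (by linarith)
    refine ⟨h, by linarith, by linarith, by linarith, ?_⟩
    rcases max_choice (-α) (α - y) with e | e <;> rw [e] <;> simp

lemma cl_cases {s r : ℝ} (hs : 0 ≤ s) :
    (0 ≤ r → 0 ≤ cl s r ∧ cl s r ≤ r) ∧ (r ≤ 0 → cl s r ≤ 0 ∧ r ≤ cl s r) ∧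
    (|cl s r| = s ∨ cl s r = r) := by
  unfold cl
  grind

lemma rh_eq {m : ℕ} {z : (ℝ × ℝ) × ℝ} {α : ℝ} (h0 : 0 ≤ α)
    (h1 : α ≤ 1) (ha : z.1.1 = 1 / (m + 2) + α * wid m) : rh m z = cl z.2 (sg α z.1.2) := by
  unfold rh
  rw [ha, al_mid h0 h1]

lemma mem_T_left {y : ℝ} (h : 0 ≤ y ∧ y ≤ 1) : ((0:ℝ), y) ∈ Tcurve :=
  Or.inl (Or.inl ⟨rfl, h⟩)

lemma mem_T_vert {y : ℝ} (n : ℕ) (h : 0 ≤ y ∧ y ≤ 1) : ((1:ℝ) / (n + 1), y) ∈ Tcurve := by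
  refine Or.inl (Or.inr (mem_iUnion.2 ⟨n, 1 - y, y, by linarith, h.1, by ring, ?_⟩))
  ext
  · simp; ring
  · simp

lemma mem_T_slant {y : ℝ} (n : ℕ) (h : 0 ≤ y ∧ y ≤ 1) :
    ((1:ℝ) / (n + 2) + y * wid n, y) ∈ Tcurve := by
  refine Or.inr (mem_iUnion.2 ⟨n, y, 1 - y, h.1, by linarith, by ring, ?_⟩)
  ext
  · simp [wid]; ring
  · simp

lemma T_cases {w : ℝ × ℝ} (hw : w ∈ Tcurve) : (0 ≤ w.2 ∧ w.2 ≤ 1) ∧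
    (w.1 = 0 ∨ (∃ n : ℕ, w.1 = 1 / (n + 1)) ∨ ∃ n : ℕ, w.1 = 1 / (n + 2) + w.2 * wid n) := by
  rcases hw with (⟨h, h'⟩ | h) | h
  · exact ⟨h', Or.inl h⟩
  · obtain ⟨n, a, b, ha, hb, hab, rfl⟩ := mem_iUnion.1 h
    refine ⟨by simp; constructor <;> linarith, Or.inr (Or.inl ⟨n, ?_⟩)⟩
    simp
    rw [← add_mul, hab, one_mul]
  · obtain ⟨n, a, b, ha, hb, hab, rfl⟩ := mem_iUnion.1 h
    refine ⟨by simp; constructor <;> linarith, Or.inr (Or.inr ⟨n, ?_⟩)⟩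
    simp [wid]
    obtain rfl : b = 1 - a := by linarith
    ring

lemma T_sub {w : ℝ × ℝ} (hw : w ∈ Tcurve) : w ∈ unitSq := by
  obtain ⟨h, h'⟩ := T_cases hw
  refine ⟨?_, h⟩
  show 0 ≤ w.1 ∧ w.1 ≤ 1
  rcases h' with h' | ⟨n, h'⟩ | ⟨n, h'⟩
  · rw [h']; norm_num
  · rw [h']
    refine ⟨by positivity, ?_⟩
    rw [div_le_one (by positivity)]
    have : (0:ℝ) ≤ n := by positivity
    linarith
  · rw [h']
    obtain ⟨l1, l2⟩ := strip_le (m := n) h.1 h.2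
    refine ⟨le_trans (by positivity) l1, l2.trans ?_⟩
    rw [div_le_one (by positivity)]
    have : (0:ℝ) ≤ n := by positivity
    linarith

lemma rh_of_T {z : (ℝ × ℝ) × ℝ} (hz : z ∈ K) (h : z.1 ∈ Tcurve) (n : ℕ) : rh n z = 0 := by
  obtain ⟨hy, h'⟩ := T_cases h
  rcases h' with h' | ⟨m, h'⟩ | ⟨m, h'⟩
  · exact rh_of_snd hz (snd_of_fst hz h') n
  · have e : z.1.1 = 1 / (m + 2) + 1 * wid m := by rw [h', wid]; ring
    by_cases hn : n = m
    · subst hn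
      rw [rh_eq zero_le_one le_rfl e, sg_one hy.2, cl_zero hz.2.1]
    · exact rh_strip hn hz zero_le_one le_rfl e
  · by_cases hn : n = m
    · subst hn
      rw [rh_eq hy.1 hy.2 h', sg_diag hy.1 hy.2, cl_zero hz.2.1]
    · exact rh_strip hn hz hy.1 hy.2 h'

/-- the retraction -/
noncomputable def R (z : (ℝ × ℝ) × ℝ) : (ℝ × ℝ) × ℝ :=
  ((z.1.1 + rs (fun n => wid n / 2) z, z.1.2 + rs (fun _ => 1) z), z.2 - |rs (fun _ => 1) z|)

def E : Set ((ℝ × ℝ) × ℝ) := {z | z ∈ K ∧ (z.2 = 0 ∨ z.1 ∈ Tcurve)}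

lemma R_of_E {z : (ℝ × ℝ) × ℝ} (hz : z ∈ E) : R z = z := by
  have : ∀ n, rh n z = 0 := by
    rcases hz.2 with h | h
    · exact rh_of_snd hz.1 h
    · exact rh_of_T hz.1 h
  unfold R
  simp [rs_zero _ this]

lemma R_mem {z : (ℝ × ℝ) × ℝ} (hz : z ∈ K) : R z ∈ E := by
  rcases eq_or_lt_of_le hz.1.1.1 with h | h
  · have : z ∈ E := ⟨hz, Or.inl (snd_of_fst hz h.symm)⟩
    rwa [R_of_E this]
  · obtain ⟨m, α, h0, h1, ha⟩ := exists_strip h hz.1.1.2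
    unfold R
    rw [rs_strip _ hz h0 h1 ha, rs_strip _ hz h0 h1 ha, rh_eq h0 h1 ha, one_mul]
    obtain ⟨⟨⟨_, hx1⟩, hy0, hy1⟩, hs, hsa⟩ := hz
    have hw := wid_pos m
    have hw1 := wid_le m
    have hab := cl_abs (s := z.2) (r := sg α z.1.2) hs
    obtain ⟨c1, c2, c3⟩ := cl_cases (s := z.2) (r := sg α z.1.2) hs
    have scs := sg_cases h0 h1 hy0 hy1
    set y := z.1.2 with hy
    set S := sg α y with hS
    set r := cl z.2 S with hr
    have ha' : z.1.1 + wid m / 2 * r = 1 / (m + 2) + (α + r / 2) * wid m := by rw [ha]; ring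
    have hα' : 0 ≤ α + r / 2 ∧ α + r / 2 ≤ 1 ∧ 0 ≤ y + r ∧ y + r ≤ 1 := by
      rcases scs with ⟨q1, q2, q3, q4, -⟩ | ⟨q1, q2, q3, q4, -⟩
      · have := c1 q2
        refine ⟨?_, ?_, ?_, ?_⟩ <;> linarith
      · have := c2 q2
        refine ⟨?_, ?_, ?_, ?_⟩ <;> linarith
    obtain ⟨p1, p2, p3, p4⟩ := hα'
    obtain ⟨l1, l2⟩ := strip_le (m := m) p1 p2
    refine ⟨⟨⟨⟨?_, ?_⟩, p3, p4⟩, by simpa using hab, ?_⟩, ?_⟩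
    · show 0 ≤ z.1.1 + wid m / 2 * r
      rw [ha']; exact le_trans (by positivity) l1
    · show z.1.1 + wid m / 2 * r ≤ 1
      rw [ha']
      refine l2.trans ?_
      rw [div_le_one (by positivity)]
      have : (0:ℝ) ≤ m := by positivity
      linarith
    · show z.2 - |r| ≤ z.1.1 + wid m / 2 * r
      have : -|r| ≤ r := neg_abs_le r
      have : 0 ≤ |r| := abs_nonneg r
      nlinarith
    · rcases c3 with c3 | c3
      · left; show z.2 - |r| = 0
        rw [c3]; ring
      · right
        show (z.1.1 + wid m / 2 * r, y + r) ∈ Tcurve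
        rw [ha']
        rcases scs with ⟨q1, q2, q3, q4, q | q⟩ | ⟨q1, q2, q3, q4, q | q⟩
        · have : α + r / 2 = 1 := by rw [c3, q]; ring
          rw [this]
          have := mem_T_vert m ⟨p3, p4⟩
          convert this using 2
          unfold wid; ring
        · have : α + r / 2 = y + r := by rw [c3, q]; ring
          rw [this]
          exact mem_T_slant m ⟨p3, p4⟩
        · have : α + r / 2 = 0 := by rw [c3, q]; ring
          rw [this]
          have := mem_T_vert (m + 1) ⟨p3, p4⟩
          convert this using 2
          push_cast; ring
        · have : α + r / 2 = y + r := by rw [c3, q]; ring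
          rw [this]
          exact mem_T_slant m ⟨p3, p4⟩

lemma R_cont : Continuous (fun z : K => R z) := by
  have h1 := rs_cont (fun n => wid n / 2) (fun n => by
    rw [abs_of_pos (by have := wid_pos n; linarith)]
    have := wid_le n
    linarith)
  have h2 := rs_cont (fun _ => 1) (fun n => by simp)
  unfold R
  fun_prop

/-- the continuous retraction `K → E` -/
noncomputable def RE : C(K, E) := ⟨fun z => ⟨R z, R_mem z.2⟩, R_cont.subtype_mk _⟩

lemma unitSq_compact : IsCompact unitSq := isCompact_Icc.prod isCompact_Icc

lemma K_closed : IsClosed K := by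
  have h1 : IsClosed {z : (ℝ × ℝ) × ℝ | z.1 ∈ unitSq} :=
    unitSq_compact.isClosed.preimage continuous_fst
  have h2 : IsClosed {z : (ℝ × ℝ) × ℝ | 0 ≤ z.2} := isClosed_le (by fun_prop) (by fun_prop)
  have h3 : IsClosed {z : (ℝ × ℝ) × ℝ | z.2 ≤ z.1.1} := isClosed_le (by fun_prop) (by fun_prop)
  exact h1.inter (h2.inter h3)

lemma K_convex : Convex ℝ K := by
  rintro z ⟨⟨⟨a1, a2⟩, a3, a4⟩, a5, a6⟩ w ⟨⟨⟨b1, b2⟩, b3, b4⟩, b5, b6⟩ s t hs ht hst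
  obtain rfl : s = 1 - t := by linarith
  refine ⟨⟨⟨?_, ?_⟩, ?_, ?_⟩, ?_, ?_⟩ <;> simp <;> nlinarith

lemma diag_mem {w : ℝ × ℝ} (hw : w ∈ unitSq) : (w, w.1) ∈ K := ⟨hw, hw.1.1, le_rfl⟩

lemma bot_mem {w : ℝ × ℝ} (hw : w ∈ unitSq) : (w, (0:ℝ)) ∈ K := ⟨hw, le_rfl, hw.1.1⟩

lemma T_closed : IsClosed Tcurve := by
  have hc : Continuous (fun w : unitSq => (R (w, (w:ℝ × ℝ).1))) := by
    have : Continuous (fun w : unitSq => (⟨(w, (w:ℝ×ℝ).1), diag_mem w.2⟩ : K)) := by fun_prop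
    exact R_cont.comp this
  have hcl : IsClosed {w : unitSq | R (w, (w:ℝ × ℝ).1) = ((w : ℝ × ℝ), (w:ℝ × ℝ).1)} :=
    isClosed_eq hc (by fun_prop)
  have := (unitSq_compact.isClosed.isClosedEmbedding_subtypeVal.isClosed_iff_image_isClosed).1 hcl
  convert this using 1
  ext w
  constructor
  · intro hw
    exact ⟨⟨w, T_sub hw⟩, R_of_E ⟨diag_mem (T_sub hw), Or.inr hw⟩, rfl⟩
  · rintro ⟨w, hw, rfl⟩
    have h := R_mem (diag_mem w.2)
    have hw' : R (w, (w:ℝ × ℝ).1) = ((w : ℝ × ℝ), (w:ℝ × ℝ).1) := hw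
    rw [hw'] at h
    rcases h.2 with h' | h'
    · have h'' : (w:ℝ×ℝ).1 = 0 := h'
      have := mem_T_left w.2.2
      rw [← h''] at this
      exact this
    · exact h'

instance : CompactSpace Tcurve :=
  isCompact_iff_compactSpace.1 (unitSq_compact.of_isClosed_subset T_closed fun _ h => T_sub h)

instance : CompactSpace unitSq := isCompact_iff_compactSpace.1 unitSq_compact

/-- parametrization of `E` -/
def q : unitSq ⊕ (Tcurve × I) → E := Sum.elim
  (fun w => ⟨((w : ℝ × ℝ), 0), bot_mem w.2, Or.inl rfl⟩)
  (fun a => ⟨((a.1 : ℝ × ℝ), (a.2 : ℝ) * (a.1 : ℝ × ℝ).1), ⟨T_sub a.1.2,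
    mul_nonneg a.2.2.1 (T_sub a.1.2).1.1,
    mul_le_of_le_one_left (T_sub a.1.2).1.1 a.2.2.2⟩, Or.inr a.1.2⟩)

lemma q_quot : IsQuotientMap q := by
  have hc : Continuous q := by
    unfold q
    refine Continuous.sumElim ?_ ?_ <;> fun_prop
  refine hc.isClosedMap.isQuotientMap hc ?_
  rintro ⟨⟨w, s⟩, hK, h⟩
  by_cases hs : s = 0
  · subst hs
    exact ⟨Sum.inl ⟨w, hK.1⟩, rfl⟩
  · have hw : w ∈ Tcurve := h.resolve_left hs
    have h1 : 0 ≤ s := hK.2.1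
    have h2 : s ≤ w.1 := hK.2.2
    have h3 : 0 < w.1 := lt_of_lt_of_le (lt_of_le_of_ne h1 (Ne.symm hs)) h2
    refine ⟨Sum.inr (⟨w, hw⟩, ⟨s / w.1, by positivity, by rw [div_le_one h3]; exact h2⟩), ?_⟩
    apply Subtype.ext
    show (w, s / w.1 * w.1) = (w, s)
    rw [div_mul_cancel₀ _ h3.ne']


/-! ### The cylinder space -/

noncomputable section Cyl

variable {X : Type*} [TopologicalSpace X]

def nRel (γ : C(ℝ, X)) : (Tcurve × X) ⊕ K → (Tcurve × X) ⊕ K → Prop := fun a b =>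
  ∃ (t : Tcurve) (u : X) (z : K), (z : (ℝ × ℝ) × ℝ).1 = t ∧
    ((t : ℝ × ℝ).1 = 0 ∨ u = γ ((z : (ℝ × ℝ) × ℝ).2 / (t : ℝ × ℝ).1)) ∧
    a = Sum.inl (t, u) ∧ b = Sum.inr z

def N (γ : C(ℝ, X)) := Quot (nRel γ)

instance (γ : C(ℝ, X)) : TopologicalSpace (N γ) :=
  inferInstanceAs (TopologicalSpace (Quot (nRel γ)))

def nT (γ : C(ℝ, X)) : C(Tcurve × X, N γ) :=
  ⟨fun a => Quot.mk _ (Sum.inl a), continuous_quot_mk.comp continuous_inl⟩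

def nK (γ : C(ℝ, X)) : C(K, N γ) :=
  ⟨fun a => Quot.mk _ (Sum.inr a), continuous_quot_mk.comp continuous_inr⟩

def sT (x : X) : C(Tcurve × X, SC X x) :=
  ⟨fun a => Quot.mk _ (Sum.inl a), continuous_quot_mk.comp continuous_inl⟩

def sQ (x : X) : C(unitSq, SC X x) :=
  ⟨fun a => Quot.mk _ (Sum.inr a), continuous_quot_mk.comp continuous_inr⟩

lemma n_rel (γ : C(ℝ, X)) {t : Tcurve} {u : X} {z : K} (h : (z : (ℝ × ℝ) × ℝ).1 = t)
    (h' : (t : ℝ × ℝ).1 = 0 ∨ u = γ ((z : (ℝ × ℝ) × ℝ).2 / (t : ℝ × ℝ).1)) :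
    nT γ (t, u) = nK γ z :=
  Quot.sound ⟨t, u, z, h, h', rfl, rfl⟩

lemma s_rel (x : X) {t : Tcurve} {u : X} {w : unitSq} (h : (w : ℝ × ℝ) = t)
    (h' : (t : ℝ × ℝ).1 = 0 ∨ u = x) :
    sT x (t, u) = sQ x w := by
  refine Quot.sound ?_
  by_cases ht : (t : ℝ × ℝ).1 = 0
  · exact Or.inr ⟨t, u, w, ht, h.symm, rfl, rfl⟩
  · obtain rfl := h'.resolve_left ht
    exact Or.inl ⟨t, w, ht, h.symm, rfl, rfl⟩

lemma s_ext {x : X} {P : SC X x → Prop} (h1 : ∀ a, P (sT x a)) (h2 : ∀ a, P (sQ x a)) (v) : P v := by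
  induction v using Quot.ind with
  | mk v =>
    rcases v with v | v
    · exact h1 v
    · exact h2 v

lemma n_ext {γ : C(ℝ, X)} {P : N γ → Prop} (h1 : ∀ a, P (nT γ a)) (h2 : ∀ a, P (nK γ a)) (v) :
    P v := by
  induction v using Quot.ind with
  | mk v =>
    rcases v with v | v
    · exact h1 v
    · exact h2 v

def nLift (γ : C(ℝ, X)) {Z : Type*} [TopologicalSpace Z] (f : C(Tcurve × X, Z)) (g : C(K, Z))
    (h : ∀ (t : Tcurve) (u : X) (z : K), (z : (ℝ × ℝ) × ℝ).1 = t →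
      ((t : ℝ × ℝ).1 = 0 ∨ u = γ ((z : (ℝ × ℝ) × ℝ).2 / (t : ℝ × ℝ).1)) → f (t, u) = g z) :
    C(N γ, Z) :=
  ⟨Quot.lift (Sum.elim f g) (by
    rintro _ _ ⟨t, u, z, h1, h2, rfl, rfl⟩
    exact h t u z h1 h2),
   continuous_quot_lift _ (f.continuous.sumElim g.continuous)⟩

def sLift (x : X) {Z : Type*} [TopologicalSpace Z] (f : C(Tcurve × X, Z)) (g : C(unitSq, Z))
    (h : ∀ (t : Tcurve) (u : X) (w : unitSq), (w : ℝ × ℝ) = t →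
      ((t : ℝ × ℝ).1 = 0 ∨ u = x) → f (t, u) = g w) :
    C(SC X x, Z) :=
  ⟨Quot.lift (Sum.elim f g) (by
    rintro _ _ (⟨t, w, h1, h2, rfl, rfl⟩ | ⟨t, u, w, h1, h2, rfl, rfl⟩)
    · exact h t x w h2.symm (Or.inr rfl)
    · exact h t u w h2.symm (Or.inl h1)),
   continuous_quot_lift _ (f.continuous.sumElim g.continuous)⟩

open Classical in
/-- the map `E → SC` -/
def eFun (γ : C(ℝ, X)) (x : X) (z : E) : SC X x :=
  if h : (z : (ℝ × ℝ) × ℝ).1 ∈ Tcurve then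
    sT x (⟨_, h⟩, γ ((z : (ℝ × ℝ) × ℝ).2 / (z : (ℝ × ℝ) × ℝ).1.1))
  else sQ x ⟨_, z.2.1.1⟩

lemma eFun_T (γ : C(ℝ, X)) (x : X) (hx : γ 0 = x) (z : E) (t : Tcurve) (u : X)
    (h : (z : (ℝ × ℝ) × ℝ).1 = t)
    (h' : (t : ℝ × ℝ).1 = 0 ∨ u = γ ((z : (ℝ × ℝ) × ℝ).2 / (t : ℝ × ℝ).1)) :
    eFun γ x z = sT x (t, u) := by
  have hz : (z : (ℝ × ℝ) × ℝ).1 ∈ Tcurve := h ▸ t.2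
  unfold eFun
  rw [dif_pos hz]
  have ht : (⟨_, hz⟩ : Tcurve) = t := Subtype.ext h
  rw [ht, h]
  by_cases h0 : (t : ℝ × ℝ).1 = 0
  · rw [s_rel x (w := ⟨t, T_sub t.2⟩) rfl (Or.inl h0), s_rel x (w := ⟨t, T_sub t.2⟩) rfl (Or.inl h0)]
  · rw [h'.resolve_left h0]

lemma eFun_Q (γ : C(ℝ, X)) (x : X) (hx : γ 0 = x) (z : E) (w : unitSq)
    (h : (z : (ℝ × ℝ) × ℝ).1 = w) (h' : (z : (ℝ × ℝ) × ℝ).2 = 0) :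
    eFun γ x z = sQ x w := by
  by_cases hz : (z : (ℝ × ℝ) × ℝ).1 ∈ Tcurve
  · rw [eFun_T γ x hx z ⟨_, hz⟩ x rfl (Or.inr (by rw [h', zero_div, hx]))]
    exact s_rel x h.symm (Or.inr rfl)
  · unfold eFun
    rw [dif_neg hz]
    congr 1
    exact Subtype.ext h

lemma eFun_cont (γ : C(ℝ, X)) (x : X) (hx : γ 0 = x) : Continuous (eFun γ x) := by
  rw [q_quot.continuous_iff]
  have : eFun γ x ∘ q = Sum.elim (sQ x) (fun a : Tcurve × I => sT x (a.1, γ a.2)) := by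
    funext a
    rcases a with w | ⟨t, s⟩
    · exact eFun_Q γ x hx _ w rfl rfl
    · refine eFun_T γ x hx _ t _ rfl ?_
      by_cases h0 : (t : ℝ × ℝ).1 = 0
      · exact Or.inl h0
      · right
        show γ s = γ ((s : ℝ) * (t : ℝ × ℝ).1 / (t : ℝ × ℝ).1)
        rw [mul_div_cancel_right₀ _ h0]
  rw [this]
  refine Continuous.sumElim (by fun_prop) (by fun_prop)

def ret (γ : C(ℝ, X)) (x : X) (hx : γ 0 = x) : C(N γ, SC X x) :=
  nLift γ (sT x) (ContinuousMap.comp ⟨eFun γ x, eFun_cont γ x hx⟩ RE) (by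
    intro t u z h h'
    have hE : (z : (ℝ × ℝ) × ℝ) ∈ E := ⟨z.2, Or.inr (h ▸ t.2)⟩
    have hR : RE z = ⟨z, hE⟩ := Subtype.ext (R_of_E hE)
    show _ = eFun γ x (RE z)
    rw [hR]
    exact (eFun_T γ x hx _ t u h h').symm)

def inc (γ : C(ℝ, X)) (x : X) (hx : γ 0 = x) : C(SC X x, N γ) :=
  sLift x (nT γ) ((nK γ).comp ⟨fun w => ⟨((w : ℝ × ℝ), 0), bot_mem w.2⟩, by fun_prop⟩) (by
    intro t u w h h'
    refine n_rel γ h (h'.imp id ?_)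
    rintro rfl
    simp [hx])

lemma ret_inc (γ : C(ℝ, X)) (x : X) (hx : γ 0 = x) :
    (ret γ x hx).comp (inc γ x hx) = ContinuousMap.id _ := by
  ext v
  refine s_ext (P := fun v => (ret γ x hx).comp (inc γ x hx) v = ContinuousMap.id _ v) ?_ ?_ v
  · intro a; rfl
  · intro w
    have hE : (((w : ℝ × ℝ), (0:ℝ)) : (ℝ × ℝ) × ℝ) ∈ E := ⟨bot_mem w.2, Or.inl rfl⟩
    have hR : RE ⟨((w : ℝ × ℝ), 0), bot_mem w.2⟩ = ⟨_, hE⟩ := Subtype.ext (R_of_E hE)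
    show eFun γ x (RE ⟨((w : ℝ × ℝ), 0), bot_mem w.2⟩) = sQ x w
    rw [hR]
    exact eFun_Q γ x hx _ w rfl rfl

lemma inc_eFun (γ : C(ℝ, X)) (x : X) (hx : γ 0 = x) (z : E) :
    inc γ x hx (eFun γ x z) = nK γ ⟨z, z.2.1⟩ := by
  by_cases hz : (z : (ℝ × ℝ) × ℝ).1 ∈ Tcurve
  · rw [eFun_T γ x hx z ⟨_, hz⟩ _ rfl (Or.inr rfl)]
    exact n_rel γ rfl (Or.inr rfl)
  · have h0 := z.2.2.resolve_right hz
    rw [eFun_Q γ x hx z ⟨_, z.2.1.1⟩ rfl h0]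
    show nK γ _ = nK γ _
    congr 1
    apply Subtype.ext
    exact Prod.ext rfl h0.symm

/-- the straight line deformation in `K` -/
def lineK : C(K × I, K) :=
  ⟨fun a => ⟨(1 - (a.2 : ℝ)) • (a.1 : (ℝ × ℝ) × ℝ) + (a.2 : ℝ) • R a.1,
    K_convex a.1.2 (R_mem a.1.2).1 (by linarith [a.2.2.2]) a.2.2.1 (by ring)⟩, by
    have := R_cont.comp (continuous_fst (X := K) (Y := I))
    have h2 : Continuous fun a : K × I => R a.1 := this
    fun_prop⟩

lemma lineK_E (z : K) (s : I) (h : (z : (ℝ × ℝ) × ℝ) ∈ E) : lineK (z, s) = z := by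
  apply Subtype.ext
  show (1 - (s : ℝ)) • (z : (ℝ × ℝ) × ℝ) + (s : ℝ) • R z = z
  rw [R_of_E h, ← add_smul]
  simp

def hom (γ : C(ℝ, X)) : C(N γ, C(I, N γ)) :=
  nLift γ (ContinuousMap.curry ((nT γ).comp ContinuousMap.fst))
    (ContinuousMap.curry ((nK γ).comp lineK)) (by
    intro t u z h h'
    ext s
    show nT γ (t, u) = nK γ (lineK (z, s))
    rw [lineK_E z s ⟨z.2, Or.inr (h ▸ t.2)⟩]
    exact n_rel γ h h')

lemma inc_ret (γ : C(ℝ, X)) (x : X) (hx : γ 0 = x) :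
    (ContinuousMap.id _).Homotopic ((inc γ x hx).comp (ret γ x hx)) := by
  refine ⟨⟨(ContinuousMap.uncurry (hom γ)).comp ContinuousMap.prodSwap, ?_, ?_⟩⟩
  · intro v
    show hom γ v 0 = v
    refine n_ext (P := fun v => hom γ v 0 = v) ?_ ?_ v
    · intro a; rfl
    · intro z
      show nK γ (lineK (z, 0)) = nK γ z
      congr 1
      apply Subtype.ext
      show (1 - ((0 : I) : ℝ)) • (z : (ℝ × ℝ) × ℝ) + ((0 : I) : ℝ) • R z = z
      simp
  · intro v
    show hom γ v 1 = inc γ x hx (ret γ x hx v)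
    refine n_ext (P := fun v => hom γ v 1 = inc γ x hx (ret γ x hx v)) ?_ ?_ v
    · intro a; rfl
    · intro z
      show nK γ (lineK (z, 1)) = inc γ x hx (eFun γ x (RE z))
      rw [inc_eFun]
      congr 1
      apply Subtype.ext
      show (1 - ((1 : I) : ℝ)) • (z : (ℝ × ℝ) × ℝ) + ((1 : I) : ℝ) • R z = R z
      simp

def equivN (γ : C(ℝ, X)) (x : X) (hx : γ 0 = x) : ContinuousMap.HomotopyEquiv (SC X x) (N γ) where
  toFun := inc γ x hx
  invFun := ret γ x hx
  left_inv := by rw [ret_inc]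
  right_inv := (inc_ret γ x hx).symm

def flipK : C(K, K) :=
  ⟨fun z => ⟨((z : (ℝ × ℝ) × ℝ).1, (z : (ℝ × ℝ) × ℝ).1.1 - (z : (ℝ × ℝ) × ℝ).2),
    z.2.1, sub_nonneg.2 z.2.2.2, sub_le_self _ z.2.2.1⟩, by fun_prop⟩

def flipN (γ γ' : C(ℝ, X)) (h : ∀ r, γ' r = γ (1 - r)) : C(N γ, N γ') :=
  nLift γ (nT γ') ((nK γ').comp flipK) (by
    intro t u z hz h'
    refine n_rel γ' hz ?_
    by_cases h0 : (t : ℝ × ℝ).1 = 0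
    · exact Or.inl h0
    · right
      rw [h'.resolve_left h0, h]
      show _ = γ (1 - ((z : (ℝ × ℝ) × ℝ).1.1 - (z : (ℝ × ℝ) × ℝ).2) / (t : ℝ × ℝ).1)
      rw [hz]
      congr 1
      field_simp
      ring)

lemma flip_flip (γ γ' : C(ℝ, X)) (h : ∀ r, γ' r = γ (1 - r)) (h' : ∀ r, γ r = γ' (1 - r)) (v) :
    flipN γ' γ h' (flipN γ γ' h v) = v := by
  refine n_ext (P := fun v => flipN γ' γ h' (flipN γ γ' h v) = v) ?_ ?_ v
  · intro a; rfl
  · intro z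
    show nK γ (flipK (flipK z)) = nK γ z
    congr 1
    apply Subtype.ext
    exact Prod.ext rfl (sub_sub_cancel (z : (ℝ × ℝ) × ℝ).1.1 (z : (ℝ × ℝ) × ℝ).2)

def flipH (γ γ' : C(ℝ, X)) (h : ∀ r, γ' r = γ (1 - r)) (h' : ∀ r, γ r = γ' (1 - r)) :
    N γ ≃ₜ N γ' where
  toFun := flipN γ γ' h
  invFun := flipN γ' γ h'
  left_inv := flip_flip γ γ' h h'
  right_inv := flip_flip γ' γ h' h
  continuous_toFun := (flipN γ γ' h).continuous
  continuous_invFun := (flipN γ' γ h').continuous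

end Cyl

end SnakeCone

/-- If `X` is path connected and `x, y ∈ X`, then the Snake cones
`SC(X,x)` and `SC(X,y)` are homotopy equivalent. -/
theorem SC_homotopyEquiv_of_basePoints (X : Type*) [TopologicalSpace X]
    [PathConnectedSpace X] (x y : X) :
    Nonempty (ContinuousMap.HomotopyEquiv (SC X x) (SC X y)) := by
  obtain ⟨p⟩ := PathConnectedSpace.joined x y
  let γ : C(ℝ, X) := ⟨p.extend, by fun_prop⟩
  let γ' : C(ℝ, X) := ⟨fun r => p.extend (1 - r), by fun_prop⟩
  have h0 : γ 0 = x := p.extend_zero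
  have h1 : γ' 0 = y := by
    show p.extend (1 - 0) = y
    rw [sub_zero]
    exact p.extend_one
  have h : ∀ r, γ' r = γ (1 - r) := fun r => rfl
  have h' : ∀ r, γ r = γ' (1 - r) := fun r => by
    show p.extend r = p.extend (1 - (1 - r))
    rw [sub_sub_cancel]
  exact ⟨((SnakeCone.equivN γ x h0).trans
    (SnakeCone.flipH γ γ' h h').toHomotopyEquiv).trans (SnakeCone.equivN γ' y h1).symm⟩
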